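/- arXiv:1902.06041 — 3 statements merged into one kernel-verified Lean document; each statement's English description precedes it below -/
import Mathlib

section
/- Assume LICQ holds on S. Then there exists a real number R > 0 such that for every x ∈ Γ(f,S) with ‖x‖ > R there exist real numbers λ_1, …, λ_l, ν_1, …, ν_m, μ with ∇f(x) − Σ_{i=1}^{l} λ_i ∇g_i(x) − Σ_{j=1}^{m} ν_j ∇h_j(x) − μ x = 0 and ν_j h_j(x) = 0 for j = 1, …, m (i.e., the Fritz–John multiplier κ in the definition of the tangency variety can be taken equal to 1 outside the ball of radius R). -/
open Filter

noncomputable section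

def IsPolyFun {n : ℕ} (f : EuclideanSpace ℝ (Fin n) → ℝ) : Prop :=
  ∃ P : MvPolynomial (Fin n) ℝ, ∀ x, f x = MvPolynomial.eval (fun i => x i) P

def conSet {n l m : ℕ} (g : Fin l → EuclideanSpace ℝ (Fin n) → ℝ)
    (h : Fin m → EuclideanSpace ℝ (Fin n) → ℝ) : Set (EuclideanSpace ℝ (Fin n)) :=
  {x | (∀ i, g i x = 0) ∧ (∀ j, 0 ≤ h j x)}

def LICQ {n l m : ℕ} (g : Fin l → EuclideanSpace ℝ (Fin n) → ℝ)
    (h : Fin m → EuclideanSpace ℝ (Fin n) → ℝ) : Prop :=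
  ∀ x ∈ conSet g h, LinearIndependent ℝ
    (Sum.elim (fun i : Fin l => gradient (g i) x)
      (fun j : {j : Fin m // h j x = 0} => gradient (h j.1) x))

def criticalSet {n l m : ℕ} (f : EuclideanSpace ℝ (Fin n) → ℝ)
    (g : Fin l → EuclideanSpace ℝ (Fin n) → ℝ)
    (h : Fin m → EuclideanSpace ℝ (Fin n) → ℝ) : Set (EuclideanSpace ℝ (Fin n)) :=
  {x | x ∈ conSet g h ∧ ∃ (lam : Fin l → ℝ) (nu : Fin m → ℝ),
    gradient f x - ∑ i, lam i • gradient (g i) x - ∑ j, nu j • gradient (h j) x = 0 ∧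
    ∀ j, nu j * h j x = 0}

def tangencySet {n l m : ℕ} (f : EuclideanSpace ℝ (Fin n) → ℝ)
    (g : Fin l → EuclideanSpace ℝ (Fin n) → ℝ)
    (h : Fin m → EuclideanSpace ℝ (Fin n) → ℝ) : Set (EuclideanSpace ℝ (Fin n)) :=
  {x | x ∈ conSet g h ∧ ∃ (κ : ℝ) (lam : Fin l → ℝ) (nu : Fin m → ℝ) (μ : ℝ),
    (κ, lam, nu, μ) ≠ 0 ∧
    κ • gradient f x - ∑ i, lam i • gradient (g i) x - ∑ j, nu j • gradient (h j) x - μ • x = 0 ∧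
    ∀ j, nu j * h j x = 0}

def tangencyValues {n l m : ℕ} (f : EuclideanSpace ℝ (Fin n) → ℝ)
    (g : Fin l → EuclideanSpace ℝ (Fin n) → ℝ)
    (h : Fin m → EuclideanSpace ℝ (Fin n) → ℝ) : Set ℝ :=
  {lam | ∃ x : ℕ → EuclideanSpace ℝ (Fin n), (∀ k, x k ∈ tangencySet f g h) ∧
    Tendsto (fun k => ‖x k‖) atTop atTop ∧ Tendsto (fun k => f (x k)) atTop (nhds lam)}

def psi {n l m : ℕ} (f : EuclideanSpace ℝ (Fin n) → ℝ)
    (g : Fin l → EuclideanSpace ℝ (Fin n) → ℝ)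
    (h : Fin m → EuclideanSpace ℝ (Fin n) → ℝ) (t : ℝ) : EReal :=
  sInf ((fun x => (f x : EReal)) '' {x | x ∈ conSet g h ∧ ‖x‖ = t})

def CoerciveOn {n : ℕ} (f : EuclideanSpace ℝ (Fin n) → ℝ)
    (S : Set (EuclideanSpace ℝ (Fin n))) : Prop :=
  ∀ x : ℕ → EuclideanSpace ℝ (Fin n), (∀ k, x k ∈ S) →
    Tendsto (fun k => ‖x k‖) atTop atTop → Tendsto (fun k => f (x k)) atTop atTop

section Kaehler

open KaehlerDifferential TensorProduct

/-- In a finitely generated field extension of characteristic zero, an element with vanishing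
Kähler differential is algebraic over the base field. -/
theorem isAlgebraic_of_kaehlerDifferential_D_eq_zero {k K : Type*} [Field k] [CharZero k] [Field K]
    [Algebra k K] [Algebra.EssFiniteType k K] {x : K} (hx : D k K x = 0) : IsAlgebraic k x := by
  by_contra hx'
  have hinj : Function.Injective (Polynomial.aeval (R := k) x) :=
    transcendental_iff_injective.mp hx'
  let _ : Algebra (Polynomial k) K := (Polynomial.aeval (R := k) x).toAlgebra
  have : IsScalarTower k (Polynomial k) K :=
    .of_algebraMap_eq fun r => ((Polynomial.aeval (R := k) x).commutes r).symm
  have : FaithfulSMul (Polynomial k) K := (faithfulSMul_iff_algebraMap_injective _ _).mpr hinj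
  let F := FractionRing (Polynomial k)
  let _ : Algebra F K := FractionRing.liftAlgebra (Polynomial k) K
  have : IsScalarTower (Polynomial k) F K := FractionRing.isScalarTower_liftAlgebra _ _
  have : IsScalarTower k F K := .to₁₃₄ k (Polynomial k) F K
  have : CharZero F := charZero_of_injective_algebraMap (algebraMap k F).injective
  have : Algebra.EssFiniteType F K := .of_comp k F K
  have : Algebra.FormallySmooth (Polynomial k) F := .of_isLocalization (nonZeroDivisors _)
  have : Algebra.FormallySmooth (Polynomial k) K := .comp _ F _
  obtain ⟨y, hy⟩ := (Algebra.H1Cotangent.exact_δ_mapBaseChange k (Polynomial k) K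
    (1 ⊗ₜ D k (Polynomial k) Polynomial.X)).mp <| by
      rw [mapBaseChange_tmul, map_D, one_smul]
      convert hx
      exact Polynomial.aeval_X x
  rw [Subsingleton.elim y 0, map_zero] at hy
  let e : K ⊗[Polynomial k] Ω[Polynomial k⁄k] →ₗ[Polynomial k] K :=
    (TensorProduct.rid (Polynomial k) K).toLinearMap ∘ₗ
      (polynomialEquiv k).toLinearMap.lTensor K
  have := congrArg e hy
  simp [e] at this

end Kaehler

section CriticalValues

open MvPolynomial

variable {k σ τ : Type*} [Field k]

theorem Derivation.apply_mvPolynomial_aeval [Fintype σ] {A M : Type*} [CommRing A] [Algebra k A]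
    [AddCommGroup M] [Module A M] [Module k M] [IsScalarTower k A M] (d : Derivation k A M)
    (x : σ → A) (P : MvPolynomial σ k) :
    d (aeval x P) = ∑ i, aeval x (pderiv i P) • d (x i) := by
  classical
  induction P using MvPolynomial.induction_on with
  | C a => simp
  | add p q hp hq => simp [hp, hq, add_smul, Finset.sum_add_distrib]
  | mul_X p j hp =>
    simp only [map_mul, aeval_X, Derivation.leibniz, hp, pderiv_X, map_add, smul_eq_mul, add_smul,
      Finset.sum_add_distrib, Finset.smul_sum, mul_smul]
    congr 1
    simp [Pi.single_apply, apply_ite (aeval x), ite_smul]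

theorem isAlgebraic_sum_sq_of_eq_sum_smul_pderiv [CharZero k] [Fintype σ] [Fintype τ]
    {K : Type*} [Field K] [Algebra k K] [Algebra.EssFiniteType k K] (G : τ → MvPolynomial σ k)
    (x : σ → K) (c : τ → K) (hG : ∀ t, c t * aeval x (G t) = 0)
    (hx : ∀ i, x i = ∑ t, c t * aeval x (pderiv i (G t))) :
    IsAlgebraic k (∑ i, x i ^ 2) := by
  apply isAlgebraic_of_kaehlerDifferential_D_eq_zero
  set d := KaehlerDifferential.D k K
  have key (t : τ) : c t • d (aeval x (G t)) = 0 := by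
    rcases mul_eq_zero.mp (hG t) with h | h <;> simp [h]
  have : ∑ i, x i • d (x i) = 0 := by
    calc ∑ i, x i • d (x i)
        = ∑ i, (∑ t, c t * aeval x (pderiv i (G t))) • d (x i) :=
          Finset.sum_congr rfl fun i _ => by rw [← hx i]
      _ = ∑ t, c t • d (aeval x (G t)) := by
          simp only [d.apply_mvPolynomial_aeval, Finset.sum_smul, Finset.smul_sum, mul_smul]
          exact Finset.sum_comm
      _ = 0 := Finset.sum_eq_zero fun t _ => key t
  simp [pow_two, ← two_smul K, ← Finset.smul_sum, this]

/-- Algebraic Sard theorem for the squared distance to the origin: it takes finitely many values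
on the points satisfying the Lagrange conditions. -/
theorem finite_setOf_sum_sq_eq_of_eq_sum_smul_pderiv [CharZero k] [Fintype σ] [Fintype τ]
    (G : τ → MvPolynomial σ k) :
    {r : k | ∃ (x : σ → k) (c : τ → k), (∀ t, c t * eval x (G t) = 0) ∧
      (∀ i, x i = ∑ t, c t * eval x (pderiv i (G t))) ∧ ∑ i, x i ^ 2 = r}.Finite := by
  let A := MvPolynomial (σ ⊕ τ) k
  let X₁ : σ → A := fun i => X (Sum.inl i)
  let X₂ : τ → A := fun t => X (Sum.inr t)
  let I : Ideal A := Ideal.span (Set.range (fun t => X₂ t * aeval X₁ (G t)) ∪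
    Set.range (fun i => X₁ i - ∑ t, X₂ t * aeval X₁ (pderiv i (G t))))
  have hI : ∀ p ∈ I.minimalPrimes, ∃ q : Polynomial k, q ≠ 0 ∧
      Polynomial.aeval (∑ i, X₁ i ^ 2) q ∈ p := by
    intro p hp
    have : p.IsPrime := hp.1.1
    have hIp : I ≤ p := hp.1.2
    let K := FractionRing (A ⧸ p)
    let φ : A →ₐ[k] K := IsScalarTower.toAlgHom k A K
    have hφ (a : A) : φ a = 0 ↔ a ∈ p := by
      rw [← Ideal.Quotient.eq_zero_iff_mem,
        ← (IsFractionRing.injective (A ⧸ p) K).eq_iff' (map_zero _)]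
      rfl
    have : Algebra.EssFiniteType (A ⧸ p) K := .of_isLocalization _ (nonZeroDivisors (A ⧸ p))
    have : Algebra.EssFiniteType k K := .comp k (A ⧸ p) K
    have haeval (P : MvPolynomial σ k) : φ (aeval X₁ P) = aeval (fun i => φ (X₁ i)) P := by
      rw [← AlgHom.comp_apply, comp_aeval]
    obtain ⟨q, hq, hq0⟩ := isAlgebraic_sum_sq_of_eq_sum_smul_pderiv G (fun i => φ (X₁ i))
      (fun t => φ (X₂ t))
      (fun t => by
        rw [← haeval, ← map_mul, hφ]
        exact hIp (Ideal.subset_span (.inl ⟨t, rfl⟩)))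
      (fun i => by
        simp only [← haeval, ← map_mul, ← map_sum]
        rw [← sub_eq_zero, ← map_sub, hφ]
        exact hIp (Ideal.subset_span (.inr ⟨i, rfl⟩)))
    refine ⟨q, hq, (hφ _).mp ?_⟩
    rw [← Polynomial.aeval_algHom_apply]
    simpa using hq0
  choose! q hq0 hq using hI
  refine (I.finite_minimalPrimes_of_isNoetherianRing.biUnion
    fun p _ => (q p).rootSet_finite k).subset ?_
  rintro _ ⟨x, c, hG, hx, rfl⟩
  let ev : A →ₐ[k] k := aeval (Sum.elim x c)
  have hX₁ (i : σ) : ev (X₁ i) = x i := aeval_X _ _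
  have hX₂ (t : τ) : ev (X₂ t) = c t := aeval_X _ _
  have haeval (P : MvPolynomial σ k) : ev (aeval X₁ P) = eval x P := by
    rw [← AlgHom.comp_apply, comp_aeval, funext hX₁, aeval_eq_eval]
  have hle : I ≤ RingHom.ker ev := by
    refine Ideal.span_le.mpr (Set.union_subset ?_ ?_)
    · rintro _ ⟨t, rfl⟩
      rw [SetLike.mem_coe, RingHom.mem_ker, map_mul, haeval, hX₂, hG]
    · rintro _ ⟨i, rfl⟩
      simp only [SetLike.mem_coe, RingHom.mem_ker, map_sub, map_sum, map_mul, haeval, hX₁, hX₂]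
      exact sub_eq_zero.mpr (hx i)
  have : (RingHom.ker ev).IsPrime := RingHom.ker_isPrime _
  obtain ⟨p, hp, hpe⟩ := Ideal.exists_minimalPrimes_le hle
  refine Set.mem_biUnion hp ((Polynomial.mem_rootSet_of_ne (hq0 p hp)).mpr ?_)
  have hroot := hpe (hq p hp)
  rw [RingHom.mem_ker, ← Polynomial.aeval_algHom_apply] at hroot
  simpa only [map_sum, map_pow, hX₁] using hroot

end CriticalValues

section Gradient

open MvPolynomial

theorem MvPolynomial.hasFDerivAt_eval_euclideanSpace {n : ℕ} (P : MvPolynomial (Fin n) ℝ)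
    (x : EuclideanSpace ℝ (Fin n)) :
    HasFDerivAt (fun y : EuclideanSpace ℝ (Fin n) => eval (fun i => y i) P)
      (∑ i, eval (fun i => x i) (pderiv i P) •
        (EuclideanSpace.proj i : EuclideanSpace ℝ (Fin n) →L[ℝ] ℝ)) x := by
  induction P using MvPolynomial.induction_on with
  | C a => simpa using hasFDerivAt_const a x
  | add p q hp hq =>
    simp only [map_add, add_smul, Finset.sum_add_distrib]
    exact hp.add hq
  | mul_X p j hp =>
    have hj : HasFDerivAt (fun y : EuclideanSpace ℝ (Fin n) => y j)
        (EuclideanSpace.proj j : EuclideanSpace ℝ (Fin n) →L[ℝ] ℝ) x :=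
      (EuclideanSpace.proj j : EuclideanSpace ℝ (Fin n) →L[ℝ] ℝ).hasFDerivAt
    simp only [map_mul, eval_X]
    refine (hp.mul hj).congr_fderiv ?_
    simp only [Derivation.leibniz, pderiv_X, map_add, smul_eq_mul, add_smul,
      Finset.sum_add_distrib, Finset.smul_sum, mul_smul, map_mul, eval_X]
    congr 1
    simp [Pi.single_apply, apply_ite (eval fun i => x i), ite_smul]

theorem gradient_apply_of_eq_eval {n : ℕ} {f : EuclideanSpace ℝ (Fin n) → ℝ}
    {P : MvPolynomial (Fin n) ℝ} (hP : ∀ x, f x = eval (fun i => x i) P)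
    (x : EuclideanSpace ℝ (Fin n)) (i : Fin n) :
    gradient f x i = eval (fun i => x i) (pderiv i P) := by
  obtain rfl : f = fun x => eval (fun i => x i) P := funext hP
  have h := InnerProductSpace.toDual_symm_apply (𝕜 := ℝ) (x := EuclideanSpace.single i (1 : ℝ))
    (y := fderiv ℝ (fun y : EuclideanSpace ℝ (Fin n) => eval (fun i => y i) P) x)
  rw [(hasFDerivAt_eval_euclideanSpace P x).fderiv, EuclideanSpace.inner_single_right] at h
  rw [gradient, (hasFDerivAt_eval_euclideanSpace P x).fderiv]
  simpa [PiLp.single_apply] using h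

end Gradient

/-- The points whose position vector is a Lagrange combination of gradients of polynomial functions
form a bounded set. -/
theorem exists_forall_norm_le_of_eq_sum_smul_gradient {n : ℕ} {τ : Type*} [Fintype τ]
    {G : τ → EuclideanSpace ℝ (Fin n) → ℝ} (hG : ∀ t, IsPolyFun (G t)) :
    ∃ R : ℝ, 0 < R ∧ ∀ (x : EuclideanSpace ℝ (Fin n)) (c : τ → ℝ), (∀ t, c t * G t x = 0) →
      x = ∑ t, c t • gradient (G t) x → ‖x‖ ≤ R := by
  choose P hP using hG
  obtain ⟨B, hB⟩ := (finite_setOf_sum_sq_eq_of_eq_sum_smul_pderiv P).bddAbove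
  refine ⟨√B + 1, by positivity, fun x c hc hx => ?_⟩
  have : ‖x‖ ^ 2 ≤ B := by
    rw [EuclideanSpace.real_norm_sq_eq]
    refine hB ⟨fun i => x i, c, fun t => hP t x ▸ hc t, fun i => ?_, rfl⟩
    simpa [gradient_apply_of_eq_eval (hP _)] using congrArg (fun y => y i) hx
  linarith [Real.le_sqrt_of_sq_le this]

theorem tangency_multiplier_normalization {n l m : ℕ} (f : EuclideanSpace ℝ (Fin n) → ℝ)
    (g : Fin l → EuclideanSpace ℝ (Fin n) → ℝ) (h : Fin m → EuclideanSpace ℝ (Fin n) → ℝ)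
    (hf : IsPolyFun f) (hg : ∀ i, IsPolyFun (g i)) (hh : ∀ j, IsPolyFun (h j))
    (hS : (conSet g h).Nonempty) (hSu : ¬ Bornology.IsBounded (conSet g h))
    (hlicq : LICQ g h) :
    ∃ R : ℝ, 0 < R ∧ ∀ x ∈ tangencySet f g h, R < ‖x‖ →
      ∃ (lam : Fin l → ℝ) (nu : Fin m → ℝ) (μ : ℝ),
        gradient f x - ∑ i, lam i • gradient (g i) x - ∑ j, nu j • gradient (h j) x - μ • x = 0 ∧
        ∀ j, nu j * h j x = 0 := by
  obtain ⟨R, hR, hbound⟩ :=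
    exists_forall_norm_le_of_eq_sum_smul_gradient (G := Sum.elim g h) (Sum.rec hg hh)
  refine ⟨R, hR, ?_⟩
  rintro x ⟨hx, κ, lam, nu, μ, hne, heq, hnu⟩ hRx
  by_cases hκ : κ = 0
  · subst hκ
    exfalso
    by_cases hμ : μ = 0
    · subst hμ
      apply hne
      have hli := Fintype.linearIndependent_iff.mp (hlicq x hx)
        (Sum.elim lam fun j => nu j.1)
      have hnu0 (j : Fin m) (hj : h j x ≠ 0) : nu j = 0 := (mul_eq_zero.mp (hnu j)).resolve_right hj
      have hsum : ∑ j : {j : Fin m // h j x = 0}, nu j.1 • gradient (h j.1) x =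
          ∑ j, nu j • gradient (h j) x := by
        classical
        rw [← Fintype.sum_subtype_add_sum_subtype (fun j => h j x = 0), left_eq_add]
        exact Finset.sum_eq_zero fun j _ => by rw [hnu0 j.1 j.2, zero_smul]
      have hz := hli (by
        simp only [Fintype.sum_sum_type, Sum.elim_inl, Sum.elim_inr, hsum]
        rw [← neg_eq_zero, ← heq]
        module)
      have hlam : lam = 0 := funext fun i => hz (.inl i)
      have hnu' : nu = 0 := funext fun j => by
        by_cases hj : h j x = 0
        · exact hz (.inr ⟨j, hj⟩)
        · exact hnu0 j hj
      rw [hlam, hnu']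
      rfl
    · refine hRx.not_ge (hbound x (Sum.elim (fun i => -μ⁻¹ * lam i) fun j => -μ⁻¹ * nu j) ?_ ?_)
      · rintro (i | j)
        · simp [hx.1 i]
        · simpa [mul_assoc] using Or.inr (mul_eq_zero.mp (hnu j))
      · have hμx : μ • x = -(∑ i, lam i • gradient (g i) x + ∑ j, nu j • gradient (h j) x) := by
          rw [← sub_eq_zero, ← neg_eq_zero, ← heq]
          module
        calc x = μ⁻¹ • μ • x := (inv_smul_smul₀ hμ x).symm
          _ = _ := by
            rw [hμx]
            simp [mul_smul, Finset.smul_sum, add_comm]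
  · refine ⟨fun i => κ⁻¹ * lam i, fun j => κ⁻¹ * nu j, κ⁻¹ * μ, ?_, fun j => by
      rw [mul_assoc, hnu j, mul_zero]⟩
    have := congrArg (κ⁻¹ • ·) heq
    simpa [smul_sub, smul_smul, Finset.smul_sum, hκ] using this
end
end

section
/- The tangency variety Γ(f,S) is nonempty, the infimum of f over S equals the infimum of f over Γ(f,S), and both are less than or equal to the infimum of f over Σ(f,S) (with the convention that the infimum over the empty set is +∞). -/
open Filter

noncomputable section

theorem IsPolyFun.contDiff {n : ℕ} {f : EuclideanSpace ℝ (Fin n) → ℝ} (hf : IsPolyFun f)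
    {k : WithTop ℕ∞} : ContDiff ℝ k f := by
  obtain ⟨P, hP⟩ := hf
  rw [show f = fun x => MvPolynomial.eval (fun i => x i) P from funext hP]
  clear hP
  induction P using MvPolynomial.induction_on with
  | C a => simpa using contDiff_const
  | add p q hp hq => simpa using hp.add hq
  | mul_X p i hp =>
    simp only [map_mul, MvPolynomial.eval_X]
    exact hp.mul (by fun_prop)

theorem isClosed_conSet {n l m : ℕ} {g : Fin l → EuclideanSpace ℝ (Fin n) → ℝ}
    {h : Fin m → EuclideanSpace ℝ (Fin n) → ℝ} (hg : ∀ i, Continuous (g i))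
    (hh : ∀ j, Continuous (h j)) : IsClosed (conSet g h) := by
  simp only [conSet, Set.ofPred_and, Set.ofPred_forall]
  exact (isClosed_iInter fun i => isClosed_eq (hg i) continuous_const).inter
    (isClosed_iInter fun j => isClosed_le continuous_const (hh j))

/-- Fritz John condition: a minimizer of `f` on a spherical section of the constraint set
lies in the tangency variety. -/
theorem mem_tangencySet_of_isMinOn {n l m : ℕ} {f : EuclideanSpace ℝ (Fin n) → ℝ}
    {g : Fin l → EuclideanSpace ℝ (Fin n) → ℝ} {h : Fin m → EuclideanSpace ℝ (Fin n) → ℝ}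
    (hf : ContDiff ℝ 1 f) (hg : ∀ i, ContDiff ℝ 1 (g i)) (hh : ∀ j, ContDiff ℝ 1 (h j))
    {y : EuclideanSpace ℝ (Fin n)} (hy : y ∈ conSet g h)
    (hmin : IsMinOn f (conSet g h ∩ {x | ‖x‖ = ‖y‖}) y) : y ∈ tangencySet f g h := by
  classical
  let F : Fin l ⊕ {j : Fin m // h j y = 0} ⊕ Unit → EuclideanSpace ℝ (Fin n) → ℝ :=
    Sum.elim g (Sum.elim (fun j => h j.1) (fun _ x => ‖x‖ ^ 2))
  have hF : ∀ i, ContDiff ℝ 1 (F i) := by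
    rintro (i | j | _)
    · exact hg i
    · exact hh j.1
    · exact contDiff_norm_sq ℝ
  have hinactive : ∀ᶠ x in nhds y, ∀ j, h j y ≠ 0 → 0 < h j x := by
    refine eventually_all.2 fun j => ?_
    by_cases hj : h j y = 0
    · simp [hj]
    · filter_upwards [(hh j).continuous.continuousAt.eventually
        (lt_mem_nhds (lt_of_le_of_ne (hy.2 j) (Ne.symm hj)))] with x hx _ using hx
  have hext : IsLocalExtrOn f {x | ∀ i, F i x = F i y} y := by
    refine Or.inl ?_
    filter_upwards [mem_nhdsWithin_of_mem_nhds hinactive, self_mem_nhdsWithin] with x hx hxF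
    refine hmin ⟨⟨fun i => (hxF (Sum.inl i)).trans (hy.1 i), fun j => ?_⟩, ?_⟩
    · by_cases hj : h j y = 0
      · exact ((hxF (Sum.inr (Sum.inl ⟨j, hj⟩))).trans hj).ge
      · exact (hx j hj).le
    · exact (sq_eq_sq₀ (norm_nonneg _) (norm_nonneg _)).1 (hxF (Sum.inr (Sum.inr ())))
  obtain ⟨Λ, κ, hne, hsum⟩ := hext.exists_multipliers_of_hasStrictFDerivAt
    (fun i => (hF i).contDiffAt.hasStrictFDerivAt one_ne_zero)
    (hf.contDiffAt.hasStrictFDerivAt one_ne_zero)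
  have hgrad := congrArg (InnerProductSpace.toDual ℝ (EuclideanSpace ℝ (Fin n))).symm hsum
  have hnorm : (InnerProductSpace.toDual ℝ (EuclideanSpace ℝ (Fin n))).symm
      (fderiv ℝ (fun x : EuclideanSpace ℝ (Fin n) => ‖x‖ ^ 2) y) = (2 : ℝ) • y := by
    rw [LinearIsometryEquiv.symm_apply_eq]
    ext v
    simp [(hasStrictFDerivAt_norm_sq y).hasFDerivAt.fderiv]
  simp only [map_add, map_sum, map_smul, map_zero, Fintype.sum_sum_type, F, Sum.elim_inl,
    Sum.elim_inr, Finset.univ_unique, Finset.sum_singleton, hnorm] at hgrad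
  let nu : Fin m → ℝ := fun j => if hj : h j y = 0 then -Λ (Sum.inr (Sum.inl ⟨j, hj⟩)) else 0
  have hnu : ∑ j, nu j • gradient (h j) y =
      -∑ j : {j : Fin m // h j y = 0}, Λ (Sum.inr (Sum.inl j)) • gradient (h j.1) y := by
    rw [← Finset.sum_neg_distrib,
      ← Fintype.sum_subtype_add_sum_subtype (fun j => h j y = 0) (fun j => nu j • gradient (h j) y),
      Finset.sum_eq_zero (s := (Finset.univ : Finset {j // ¬ h j y = 0}))
        (fun j _ => by simp [nu, j.2]), add_zero]
    exact Finset.sum_congr rfl fun j _ => by simp [nu, j.2]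
  refine ⟨hy, κ, fun i => -Λ (Sum.inl i), nu, -2 * Λ (Sum.inr (Sum.inr ())), ?_, ?_, ?_⟩
  · intro h0
    simp only [Prod.mk_eq_zero] at h0
    obtain ⟨h1, h2, h3, h4⟩ := h0
    refine hne (Prod.ext (funext ?_) h1)
    rintro (i | ⟨j, hj⟩ | _)
    · simpa using congrFun h2 i
    · simpa [nu, hj] using congrFun h3 j
    · simpa using h4
  · rw [hnu]
    rw [← hgrad]
    simp only [gradient, neg_smul, Finset.sum_neg_distrib, smul_smul, neg_mul, mul_comm]
    simp only [PUnit.default_eq_unit]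
    abel
  · intro j
    by_cases hj : h j y = 0 <;> simp [nu, hj]

theorem exists_mem_tangencySet_le {n l m : ℕ} {f : EuclideanSpace ℝ (Fin n) → ℝ}
    {g : Fin l → EuclideanSpace ℝ (Fin n) → ℝ} {h : Fin m → EuclideanSpace ℝ (Fin n) → ℝ}
    (hf : ContDiff ℝ 1 f) (hg : ∀ i, ContDiff ℝ 1 (g i)) (hh : ∀ j, ContDiff ℝ 1 (h j))
    {x : EuclideanSpace ℝ (Fin n)} (hx : x ∈ conSet g h) :
    ∃ y ∈ tangencySet f g h, f y ≤ f x := by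
  have hcpt : IsCompact (conSet g h ∩ {z | ‖z‖ = ‖x‖}) := by
    refine Metric.isCompact_of_isClosed_isBounded
      ((isClosed_conSet (fun i => (hg i).continuous) (fun j => (hh j).continuous)).inter
        (isClosed_eq continuous_norm continuous_const)) ?_
    exact (Metric.isBounded_closedBall (x := 0) (r := ‖x‖)).subset
      fun z hz => mem_closedBall_zero_iff.2 hz.2.le
  obtain ⟨y, ⟨hy, hyx⟩, hmin⟩ := hcpt.exists_isMinOn ⟨x, hx, rfl⟩ hf.continuous.continuousOn
  have hyx' : ‖y‖ = ‖x‖ := hyx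
  exact ⟨y, mem_tangencySet_of_isMinOn hf hg hh hy (hyx' ▸ hmin), hmin ⟨hx, rfl⟩⟩

theorem inf_on_tangency {n l m : ℕ} (f : EuclideanSpace ℝ (Fin n) → ℝ)
    (g : Fin l → EuclideanSpace ℝ (Fin n) → ℝ) (h : Fin m → EuclideanSpace ℝ (Fin n) → ℝ)
    (hf : IsPolyFun f) (hg : ∀ i, IsPolyFun (g i)) (hh : ∀ j, IsPolyFun (h j))
    (hS : (conSet g h).Nonempty) (hSu : ¬ Bornology.IsBounded (conSet g h)) :
    (tangencySet f g h).Nonempty ∧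
    sInf ((fun x => (f x : EReal)) '' conSet g h) =
      sInf ((fun x => (f x : EReal)) '' tangencySet f g h) ∧
    sInf ((fun x => (f x : EReal)) '' conSet g h) ≤
      sInf ((fun x => (f x : EReal)) '' criticalSet f g h) := by
  have key := fun x (hx : x ∈ conSet g h) => exists_mem_tangencySet_le (f := f) hf.contDiff
    (fun i => (hg i).contDiff) (fun j => (hh j).contDiff) hx
  refine ⟨?_, le_antisymm ?_ ?_, ?_⟩
  · obtain ⟨x, hx⟩ := hS
    obtain ⟨y, hy, -⟩ := key x hx
    exact ⟨y, hy⟩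
  · exact sInf_le_sInf (Set.image_mono fun x hx => hx.1)
  · refine le_sInf ?_
    rintro _ ⟨x, hx, rfl⟩
    obtain ⟨y, hy, hyx⟩ := key x hx
    exact (sInf_le (Set.mem_image_of_mem _ hy)).trans (EReal.coe_le_coe_iff.2 hyx)
  · exact sInf_le_sInf (Set.image_mono fun x hx => hx.1)
end
end

section
/- If LICQ holds on S, then the set T_∞(f,S) of tangency values at infinity of f on S is a finite subset of ℝ. -/
open Filter

noncomputable section

open scoped TensorProduct IntermediateField.algebraAdjoinAdjoin in
theorem IsTranscendenceBasis.linearIndependent_D {k K ι : Type*} [Field k] [Field K] [Algebra k K]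
    [CharZero k] {v : ι → K} (hv : IsTranscendenceBasis k v) :
    LinearIndependent K (fun i => KaehlerDifferential.D k K (v i)) := by
  let A := Algebra.adjoin k (Set.range v)
  let L := IntermediateField.adjoin k (Set.range v)
  have h1 : Algebra.FormallyEtale A L := .of_isLocalization (nonZeroDivisors A)
  have h2 : Algebra.IsAlgebraic L K := hv.isAlgebraic_field
  have h3 : Algebra.FormallyEtale L K := Algebra.FormallyEtale.of_isSeparable L K
  have h4 : Algebra.FormallyEtale A K := .comp A L K
  let : Algebra (MvPolynomial ι k) A := hv.1.aevalEquiv.toRingHom.toAlgebra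
  let : Algebra (MvPolynomial ι k) K := (MvPolynomial.aeval v).toAlgebra
  have h5 : IsScalarTower (MvPolynomial ι k) A K := .of_algebraMap_eq fun p =>
    (hv.1.algebraMap_aevalEquiv p).symm
  have h6 : IsScalarTower k (MvPolynomial ι k) K := .of_algebraMap_eq fun p => by
    simp [RingHom.algebraMap_toAlgebra]
  have h7 : Algebra.FormallyEtale (MvPolynomial ι k) A :=
    .of_equiv (AlgEquiv.ofBijective (Algebra.ofId (MvPolynomial ι k) A) hv.1.aevalEquiv.bijective)
  have h8 : Algebra.FormallyEtale (MvPolynomial ι k) K := .comp _ A K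
  let b := ((KaehlerDifferential.mvPolynomialBasis k ι).baseChange K).map
    (KaehlerDifferential.tensorKaehlerEquivOfFormallyEtale k (MvPolynomial ι k) K)
  convert b.linearIndependent with i
  simp [b, RingHom.algebraMap_toAlgebra]

theorem AlgebraicIndependent.linearIndependent_D {k K ι : Type*} [Field k] [Field K] [Algebra k K]
    [CharZero k] {v : ι → K} (hv : AlgebraicIndependent k v) :
    LinearIndependent K (fun i => KaehlerDifferential.D k K (v i)) := by
  obtain ⟨t, hvt, ht⟩ := exists_isTranscendenceBasis_superset hv.coe_range
  exact ht.linearIndependent_D.comp (fun i => (⟨v i, hvt ⟨i, rfl⟩⟩ : t))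
    fun i j h => hv.injective (congrArg Subtype.val h)

theorem KaehlerDifferential.D_aeval {R A σ : Type*} [CommRing R] [CommRing A] [Algebra R A]
    [Fintype σ] (x : σ → A) (p : MvPolynomial σ R) :
    D R A (MvPolynomial.aeval x p) =
      ∑ s, MvPolynomial.aeval x (MvPolynomial.pderiv s p) • D R A (x s) := by
  classical
  induction p using MvPolynomial.induction_on with
  | C a => simp
  | add p q hp hq => simp [hp, hq, add_smul, Finset.sum_add_distrib]
  | mul_X p s hp =>
    simp [hp, add_smul, Finset.sum_add_distrib, Finset.smul_sum, smul_smul, Pi.single_apply,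
      mul_comm, Derivation.leibniz, MvPolynomial.pderiv_X, apply_ite (MvPolynomial.aeval x),
      add_comm]

open MvPolynomial in
theorem MvPolynomial.not_algebraicIndependent_of_vanishingIdeal_isPrime {σ ι κ : Type*}
    [Fintype σ] [Fintype ι] [Fintype κ] (F : κ → MvPolynomial σ ℝ) (G : ι → MvPolynomial σ ℝ)
    {Z : Set (σ → ℝ)} [hI : (vanishingIdeal ℝ Z).IsPrime]
    (hG : ∀ z ∈ Z, ∀ i, eval z (G i) = 0)
    (hli : ∀ z ∈ Z, LinearIndependent ℝ (fun i s => eval z (pderiv s (G i))))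
    (hdep : ∀ z ∈ Z, ¬ LinearIndependent ℝ
      (fun (r : κ ⊕ ι) s => eval z (pderiv s (Sum.elim F G r)))) :
    ¬ AlgebraicIndependent ℝ (fun j => Ideal.Quotient.mk (vanishingIdeal ℝ Z) (F j)) := by
  classical
  intro hind
  let A := MvPolynomial σ ℝ ⧸ vanishingIdeal ℝ Z
  let K := FractionRing A
  let ev (z : Z) : A →+* ℝ := Ideal.Quotient.lift (vanishingIdeal ℝ Z) (eval z.1)
    fun p hp => by simpa using hp z.1 z.2
  have ev_mk (z : Z) (p) : ev z (Ideal.Quotient.mk _ p) = eval z.1 p := rfl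
  have ev_ext (a : A) (ha : ∀ z, ev z a = 0) : a = 0 := by
    obtain ⟨p, rfl⟩ := Ideal.Quotient.mk_surjective a
    exact Ideal.Quotient.eq_zero_iff_mem.2 fun z hz => by
      have h : eval z p = 0 := ha ⟨z, hz⟩
      simpa using h
  let M : Matrix (κ ⊕ ι) σ A := .of fun r s => Ideal.Quotient.mk _ (pderiv s (Sum.elim F G r))
  have hdet : (M * M.transpose).det = 0 := ev_ext _ fun z => by
    rw [RingHom.map_det, ← Matrix.exists_vecMul_eq_zero_iff]
    obtain ⟨c, hc, r, hr⟩ := Fintype.not_linearIndependent_iff.1 (hdep z z.2)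
    refine ⟨c, fun h => hr (congrFun h r), ?_⟩
    have : Matrix.vecMul c (M.map (ev z)) = 0 := by
      ext s
      simpa [Matrix.vecMul, dotProduct, M, ev_mk] using congrFun hc s
    rw [RingHom.mapMatrix_apply, Matrix.map_mul, ← Matrix.vecMul_vecMul, this, Matrix.zero_vecMul]
  obtain ⟨c, hc0, hc⟩ := Matrix.exists_vecMul_eq_zero_iff.2 hdet
  have hevc (z : Z) : Matrix.vecMul (ev z ∘ c) (M.map (ev z)) = 0 := by
    have h : Matrix.vecMul (ev z ∘ c) (M.map (ev z) * (M.map (ev z)).conjTranspose) = 0 := by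
      ext r
      have := congrArg (ev z) (congrFun hc r)
      rw [RingHom.map_vecMul, Matrix.map_mul] at this
      simpa [Matrix.transpose_map] using this
    exact (Matrix.vecMul_self_mul_conjTranspose_eq_zero _ _).1 h
  have hcM : Matrix.vecMul c M = 0 := by
    ext s
    exact ev_ext _ fun z => by rw [RingHom.map_vecMul, hevc z]; rfl
  have hinl (j : κ) : c (.inl j) = 0 := by
    let x (s : σ) : K := algebraMap A K (Ideal.Quotient.mk _ (X s))
    have hx (p : MvPolynomial σ ℝ) : aeval x p = algebraMap A K (Ideal.Quotient.mk _ p) := by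
      have : aeval x = (Algebra.algHom ℝ A K).comp (Ideal.Quotient.mkₐ ℝ (vanishingIdeal ℝ Z)) := by
        ext s
        simp only [aeval_X]
        rfl
      exact DFunLike.congr_fun this p
    have hindK : AlgebraicIndependent ℝ fun j => aeval x (F j) := by
      simp_rw [hx]
      exact hind.map' (f := Algebra.algHom ℝ A K) (IsFractionRing.injective A K)
    have key : ∑ r, algebraMap A K (c r) • KaehlerDifferential.D ℝ K
        (aeval x (Sum.elim F G r)) = 0 := by
      simp_rw [KaehlerDifferential.D_aeval, Finset.smul_sum, smul_smul]
      rw [Finset.sum_comm]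
      refine Finset.sum_eq_zero fun s _ => ?_
      rw [← Finset.sum_smul]
      have := congrArg (algebraMap A K) (congrFun hcM s)
      simp only [Matrix.vecMul, dotProduct, M, Matrix.of_apply, map_sum, map_mul, ← hx] at this
      rw [this, Pi.zero_apply, map_zero, zero_smul]
    have hG0 (i : ι) : aeval x (G i) = 0 := by
      rw [hx, Ideal.Quotient.eq_zero_iff_mem.2, map_zero]
      exact fun z hz => by simpa using hG z hz i
    simp only [Fintype.sum_sum_type, Sum.elim_inl, Sum.elim_inr, hG0, map_zero, smul_zero,
      Finset.sum_const_zero, add_zero] at key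
    have := Fintype.linearIndependent_iff.1 hindK.linearIndependent_D _ key j
    exact IsFractionRing.injective A K (by simpa using this)
  have hinr (i : ι) : c (.inr i) = 0 := ev_ext _ fun z => by
    refine Fintype.linearIndependent_iff.1 (hli z z.2) (fun i => ev z (c (.inr i))) ?_ i
    ext s
    simpa [Matrix.vecMul, dotProduct, M, hinl, ev_mk] using congrFun (hevc z) s
  exact hc0 (_root_.funext fun
    | .inl j => hinl j
    | .inr i => hinr i)

open MvPolynomial in
/-- An algebraic form of Sard's theorem: if the points of `Z` are regular zeros of `G` at which the
gradients of `F` and `G` are dependent, then the values of `F` on `Z` satisfy a nontrivial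
polynomial relation. -/
theorem MvPolynomial.exists_eval_eq_zero_of_not_linearIndependent {σ ι κ : Type*}
    [Fintype σ] [Fintype ι] [Fintype κ] (F : κ → MvPolynomial σ ℝ) (G : ι → MvPolynomial σ ℝ)
    (Z : Set (σ → ℝ))
    (hG : ∀ z ∈ Z, ∀ i, eval z (G i) = 0)
    (hli : ∀ z ∈ Z, LinearIndependent ℝ (fun i s => eval z (pderiv s (G i))))
    (hdep : ∀ z ∈ Z, ¬ LinearIndependent ℝ
      (fun (r : κ ⊕ ι) s => eval z (pderiv s (Sum.elim F G r)))) :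
    ∃ P : MvPolynomial κ ℝ, P ≠ 0 ∧ ∀ z ∈ Z, eval (fun j => eval z (F j)) P = 0 := by
  induction hI : vanishingIdeal ℝ Z using WellFoundedGT.induction generalizing Z with
  | ind I ih =>
  subst hI
  rcases Z.eq_empty_or_nonempty with rfl | hZ
  · exact ⟨1, one_ne_zero, by simp⟩
  have step (p : MvPolynomial σ ℝ) (hp : p ∉ vanishingIdeal ℝ Z) :
      ∃ P : MvPolynomial κ ℝ, P ≠ 0 ∧
        ∀ z ∈ Z, eval z p = 0 → eval (fun j => eval z (F j)) P = 0 := by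
    obtain ⟨P, hP, h⟩ := ih (vanishingIdeal ℝ {z ∈ Z | eval z p = 0})
      (lt_of_le_of_ne (vanishingIdeal_anti_mono fun z hz => hz.1) fun h => hp <| by
        rw [h]
        exact fun z hz => by simpa using hz.2)
      _ (fun z hz => hG z hz.1) (fun z hz => hli z hz.1) (fun z hz => hdep z hz.1) rfl
    exact ⟨P, hP, fun z hz hz' => h z ⟨hz, hz'⟩⟩
  by_cases hprime : (vanishingIdeal ℝ Z).IsPrime
  · have h := not_algebraicIndependent_of_vanishingIdeal_isPrime F G hG hli hdep
    rw [algebraicIndependent_iff] at h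
    push Not at h
    obtain ⟨P, hP, hP0⟩ := h
    refine ⟨P, hP0, fun z hz => ?_⟩
    have hmk : Ideal.Quotient.mk (vanishingIdeal ℝ Z) (aeval F P) = 0 := by
      rw [← hP]
      exact comp_aeval_apply F (Ideal.Quotient.mkₐ ℝ (vanishingIdeal ℝ Z)) P
    have := Ideal.Quotient.eq_zero_iff_mem.1 hmk z hz
    rw [comp_aeval_apply] at this
    simpa using this
  · have : ∃ p q, p * q ∈ vanishingIdeal ℝ Z ∧ p ∉ vanishingIdeal ℝ Z ∧
        q ∉ vanishingIdeal ℝ Z := by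
      by_contra! h
      refine hprime ⟨fun htop => ?_, fun {p q} hpq => or_iff_not_imp_left.2 (h p q hpq)⟩
      obtain ⟨z, hz⟩ := hZ
      have : (1 : MvPolynomial σ ℝ) ∈ vanishingIdeal ℝ Z := htop ▸ Submodule.mem_top
      simpa using this z hz
    obtain ⟨p, q, hpq, hp, hq⟩ := this
    obtain ⟨P, hP, hPz⟩ := step p hp
    obtain ⟨Q, hQ, hQz⟩ := step q hq
    refine ⟨P * Q, mul_ne_zero hP hQ, fun z hz => ?_⟩
    have : eval z p * eval z q = 0 := by simpa using hpq z hz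
    rcases mul_eq_zero.1 this with h | h
    · simp [hPz z hz h]
    · simp [hQz z hz h]

theorem MvPolynomial.hasFDerivAt_eval {σ : Type*} [Fintype σ] (p : MvPolynomial σ ℝ)
    (x : EuclideanSpace ℝ σ) :
    HasFDerivAt (fun y : EuclideanSpace ℝ σ => eval (fun s => y s) p)
      (∑ s, eval (fun s => x s) (pderiv s p) • EuclideanSpace.proj (𝕜 := ℝ) s) x := by
  classical
  induction p using MvPolynomial.induction_on with
  | C a => simpa using hasFDerivAt_const a x
  | add p q hp hq =>
    simp only [map_add, add_smul, Finset.sum_add_distrib]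
    exact hp.fun_add hq
  | mul_X p s hp =>
    have hs : HasFDerivAt (fun y : EuclideanSpace ℝ σ => y s)
        (EuclideanSpace.proj (𝕜 := ℝ) s : EuclideanSpace ℝ σ →L[ℝ] ℝ) x :=
      (EuclideanSpace.proj (𝕜 := ℝ) s : EuclideanSpace ℝ σ →L[ℝ] ℝ).hasFDerivAt
    simp only [map_mul, eval_X]
    refine (hp.fun_mul hs).congr_fderiv ?_
    simp [add_smul, Finset.sum_add_distrib, Finset.smul_sum, smul_smul, Pi.single_apply,
      Derivation.leibniz, pderiv_X, apply_ite (eval _)]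

theorem gradient_apply_eq_eval_pderiv {n : ℕ} {f : EuclideanSpace ℝ (Fin n) → ℝ}
    {p : MvPolynomial (Fin n) ℝ} (hp : ∀ x, f x = MvPolynomial.eval (fun i => x i) p)
    (x : EuclideanSpace ℝ (Fin n)) (s : Fin n) :
    gradient f x s = MvPolynomial.eval (fun i => x i) (MvPolynomial.pderiv s p) := by
  obtain rfl : f = fun x => MvPolynomial.eval (fun i => x i) p := funext hp
  have h : gradient (fun x : EuclideanSpace ℝ (Fin n) => MvPolynomial.eval (fun i => x i) p) x s =
      inner ℝ (gradient (fun x : EuclideanSpace ℝ (Fin n) =>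
        MvPolynomial.eval (fun i => x i) p) x) (EuclideanSpace.single s 1) := by
    rw [EuclideanSpace.inner_single_right]
    simp
  rw [h, gradient, InnerProductSpace.toDual_symm_apply, (p.hasFDerivAt_eval x).fderiv]
  simp

open MvPolynomial in
/-- The zero set of a nonzero real polynomial in two variables has finitely many asymptotic values
of the second coordinate as the first one tends to infinity. -/
theorem MvPolynomial.finite_asymptotic_values {P : MvPolynomial (Fin 2) ℝ} (hP : P ≠ 0) :
    {a : ℝ | ∃ s t : ℕ → ℝ, (∀ k, eval ![s k, t k] P = 0) ∧ Tendsto s atTop atTop ∧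
      Tendsto t atTop (nhds a)}.Finite := by
  set Q := finSuccEquiv ℝ 1 P with hQ
  have hQ0 : Q ≠ 0 := by simpa [hQ] using hP
  set q : Polynomial ℝ := aeval (fun _ => Polynomial.X) Q.leadingCoeff with hq
  have q_eval (a : ℝ) : q.eval a = eval (fun _ => a) Q.leadingCoeff := by
    have := comp_aeval_apply (fun _ : Fin 1 => (Polynomial.X : Polynomial ℝ))
      (Polynomial.aeval a) Q.leadingCoeff
    simpa [hq, Polynomial.coe_aeval_eq_eval] using this
  have hq0 : q ≠ 0 := fun h => hQ0 <| Polynomial.leadingCoeff_eq_zero.1 <|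
    MvPolynomial.funext fun x => by
      have := q_eval (x 0)
      rw [h, Polynomial.eval_zero] at this
      rw [map_zero, this]
      congr 2
      ext i
      rw [Subsingleton.elim i 0]
  refine (q.rootSet_finite ℝ).subset ?_
  rintro a ⟨s, t, hst, hs, ht⟩
  rw [Polynomial.mem_rootSet]
  refine ⟨hq0, ?_⟩
  rw [Polynomial.coe_aeval_eq_eval, q_eval]
  let u (k i : ℕ) : ℝ := eval (fun _ => t k) (Q.coeff i) * (s k ^ i / s k ^ Q.natDegree)
  have hu (k : ℕ) : ∑ i ∈ Finset.range (Q.natDegree + 1), u k i = 0 := by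
    have h := hst k
    rw [show ![s k, t k] = Fin.cons (s k) (fun _ => t k) by
      ext i; fin_cases i <;> rfl, eval_eq_eval_mv_eval', Polynomial.eval_map,
      Polynomial.eval₂_eq_sum_range] at h
    simp only [u, ← mul_div_assoc, ← Finset.sum_div]
    rw [h, zero_div]
  have hlim (i : ℕ) (hi : i ≤ Q.natDegree) : Tendsto (fun k => u k i) atTop
      (nhds (eval (fun _ => a) (Q.coeff i) * if i = Q.natDegree then 1 else 0)) := by
    refine Tendsto.mul ?_ ?_
    · exact ((MvPolynomial.continuous_eval (Q.coeff i)).tendsto (fun _ => a)).comp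
        (tendsto_pi_nhds.2 fun _ => ht)
    · split_ifs with h
      · refine tendsto_const_nhds.congr' ?_
        filter_upwards [hs.eventually_gt_atTop 0] with k hk
        rw [h, div_self (pow_pos hk _).ne']
      · exact (tendsto_pow_div_pow_atTop_zero (lt_of_le_of_ne hi h)).comp hs
  have := tendsto_finsetSum (Finset.range (Q.natDegree + 1))
    fun i hi => hlim i (Nat.lt_succ_iff.1 (Finset.mem_range.1 hi))
  simp only [hu] at this
  simpa using (tendsto_nhds_unique this tendsto_const_nhds)

open MvPolynomial in
theorem exists_polynomial_relation_tangencySet {n l m : ℕ} {f : EuclideanSpace ℝ (Fin n) → ℝ}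
    {g : Fin l → EuclideanSpace ℝ (Fin n) → ℝ} {h : Fin m → EuclideanSpace ℝ (Fin n) → ℝ}
    (hf : IsPolyFun f) (hg : ∀ i, IsPolyFun (g i)) (hh : ∀ j, IsPolyFun (h j))
    (hlicq : LICQ g h) (J : Finset (Fin m)) :
    ∃ P : MvPolynomial (Fin 2) ℝ, P ≠ 0 ∧ ∀ x ∈ tangencySet f g h,
      (∀ j, h j x = 0 ↔ j ∈ J) → eval ![‖x‖ ^ 2, f x] P = 0 := by
  obtain ⟨pf, hpf⟩ := hf
  choose pg hpg using hg
  choose ph hph using hh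
  let N : MvPolynomial (Fin n) ℝ := ∑ s, X s ^ 2
  have hN (x : EuclideanSpace ℝ (Fin n)) : eval (fun i => x i) N = ‖x‖ ^ 2 := by
    simp [N, EuclideanSpace.norm_sq_eq]
  have hdN (s : Fin n) : pderiv s N = 2 * X s := by
    simp [N, pderiv_X, Pi.single_apply, Derivation.leibniz_pow]
  let ofLp := (WithLp.linearEquiv 2 ℝ (Fin n → ℝ)).toLinearMap
  let G : Fin l ⊕ J → MvPolynomial (Fin n) ℝ := Sum.elim pg fun j => ph j
  obtain ⟨P, hP0, hP⟩ := exists_eval_eq_zero_of_not_linearIndependent ![N, pf] G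
    ((fun x i => x i) '' {x | x ∈ tangencySet f g h ∧ ∀ j, h j x = 0 ↔ j ∈ J}) (by
      rintro _ ⟨x, ⟨hx, hJ⟩, rfl⟩ (i | j)
      · exact (hpg i x).symm.trans (hx.1.1 i)
      · exact (hph j x).symm.trans ((hJ j).2 j.2)) (by
      rintro _ ⟨x, ⟨hx, hJ⟩, rfl⟩
      have h1 := (hlicq x hx.1).comp
        (Sum.map id (fun j : J => (⟨j.1, (hJ j).2 j.2⟩ : {j // h j x = 0})))
        (Sum.map_injective.2 ⟨Function.injective_id, fun j k hjk => 
          Subtype.ext (Subtype.mk.inj hjk)⟩)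
      have h2 := h1.map' ofLp (LinearEquiv.ker _)
      have h3 : ofLp ∘ Sum.elim (fun i => gradient (g i) x)
          (fun j : {j // h j x = 0} => gradient (h j) x) ∘ Sum.map id (fun j : J =>
            ⟨j.1, (hJ j).2 j.2⟩) = fun r s => eval (fun i => x i) (pderiv s (G r)) := by
        ext (i | j) s
        · exact gradient_apply_eq_eval_pderiv (hpg i) x s
        · exact gradient_apply_eq_eval_pderiv (hph j) x s
      rw [h3] at h2
      exact h2) (by
      rintro _ ⟨x, ⟨⟨hx, κ, lam, nu, μ, hne, heq, hnu⟩, hJ⟩, rfl⟩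
      rw [Fintype.not_linearIndependent_iff]
      have hnu0 (j) (hj : j ∉ J) : nu j = 0 :=
        (mul_eq_zero.1 (hnu j)).resolve_right fun h0 => hj ((hJ j).1 h0)
      refine ⟨Sum.elim ![-(μ / 2), κ] (Sum.elim (fun i => -lam i) fun j => -nu j), ?_, ?_⟩
      · ext s
        have hs := congrArg (fun v => v s) heq
        have hsum : ∑ j, nu j * eval (fun i => x i) (pderiv s (ph j)) =
            ∑ j : J, nu j * eval (fun i => x i) (pderiv s (ph j)) := by
          rw [Finset.sum_coe_sort J fun j => nu j * eval (fun i => x i) (pderiv s (ph j))]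
          exact (Finset.sum_subset J.subset_univ fun j _ hj => by simp [hnu0 j hj]).symm
        simp [gradient_apply_eq_eval_pderiv hpf, gradient_apply_eq_eval_pderiv (hpg _),
          gradient_apply_eq_eval_pderiv (hph _), hsum] at hs
        simp [G, Fin.sum_univ_two, hdN]
        linarith
      · by_contra! hall
        apply hne
        have h1 : μ = 0 := by simpa using hall (.inl 0)
        have h2 : κ = 0 := by simpa using hall (.inl 1)
        have h3 : lam = 0 := funext fun i => by simpa using hall (.inr (.inl i))
        have h4 : nu = 0 := funext fun j => by
          by_cases hj : j ∈ J
          · simpa using hall (.inr (.inr ⟨j, hj⟩))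
          · exact hnu0 j hj
        simp [h1, h2, h3, h4])
  refine ⟨P, hP0, fun x hx hJ => ?_⟩
  rw [← hP _ ⟨x, ⟨hx, hJ⟩, rfl⟩]
  congr 2
  ext i
  fin_cases i
  · exact (hN x).symm
  · exact hpf x

theorem tangency_values_finite {n l m : ℕ} (f : EuclideanSpace ℝ (Fin n) → ℝ)
    (g : Fin l → EuclideanSpace ℝ (Fin n) → ℝ) (h : Fin m → EuclideanSpace ℝ (Fin n) → ℝ)
    (hf : IsPolyFun f) (hg : ∀ i, IsPolyFun (g i)) (hh : ∀ j, IsPolyFun (h j))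
    (hS : (conSet g h).Nonempty) (hSu : ¬ Bornology.IsBounded (conSet g h))
    (hlicq : LICQ g h) :
    (tangencyValues f g h).Finite := by
  choose P hP0 hP using exists_polynomial_relation_tangencySet hf hg hh hlicq
  refine (MvPolynomial.finite_asymptotic_values
    (Finset.prod_ne_zero_iff.2 fun J (_ : J ∈ Finset.univ) => hP0 J)).subset ?_
  rintro a ⟨x, hx, hnorm, hlim⟩
  refine ⟨fun k => ‖x k‖ ^ 2, fun k => f (x k), fun k => ?_,
    (tendsto_pow_atTop two_ne_zero).comp hnorm, hlim⟩
  classical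
  rw [map_prod]
  exact Finset.prod_eq_zero (Finset.mem_univ (Finset.univ.filter fun j => h j (x k) = 0))
    (hP _ _ (hx k) (by simp))
end
end
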